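/- arXiv:2512.19499 — 2 statements merged into one kernel-verified Lean document; each statement's English description precedes it below -/
import Mathlib

section
/- Let A and B be metric spaces with B connected and nonempty, and let F : A → B be a continuous surjective map such that (i) the preimage under F of every compact subset of B is compact, and (ii) every point of A has an open neighborhood that F maps homeomorphically onto an open subset of B. Then F is a covering map, every fiber F⁻¹({b}) with b ∈ B is finite and nonempty, and all fibers have the same cardinality. -/
open Set Topology

theorem IsEvenlyCovered.eventually_nhds {E X I : Type*} [TopologicalSpace E] [TopologicalSpace X]
    [TopologicalSpace I] {f : E → X} {x : X} (h : IsEvenlyCovered f x I) :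
    ∀ᶠ y in 𝓝 x, IsEvenlyCovered f y I :=
  have ⟨hI, U, hxU, hU, hfU, H⟩ := h
  Filter.eventually_of_mem (hU.mem_nhds hxU) fun _ hy ↦ ⟨hI, U, hy, hU, hfU, H⟩

theorem IsCoveringMap.isLocallyConstant_ncard_fiber {E X : Type*} [TopologicalSpace E]
    [TopologicalSpace X] {f : E → X} (hf : IsCoveringMap f) :
    IsLocallyConstant fun x ↦ (f ⁻¹' {x}).ncard := by
  refine (IsLocallyConstant.iff_eventually_eq _).mpr fun x ↦ ?_
  filter_upwards [(hf x).eventually_nhds] with y hy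
  exact (Nat.card_congr hy.fiberHomeomorph.toEquiv).symm

theorem statement2 {A B : Type*} [MetricSpace A] [MetricSpace B]
    [ConnectedSpace B]
    (F : A → B) (hc : Continuous F) (hsurj : Function.Surjective F)
    (hproper : ∀ K : Set B, IsCompact K → IsCompact (F ⁻¹' K))
    (hloc : ∀ a : A, ∃ V : Set A, IsOpen V ∧ a ∈ V ∧ IsOpen (F '' V) ∧
      ∃ e : ↥V ≃ₜ ↥(F '' V), ∀ v : ↥V, (e v : B) = F v) :
    IsCoveringMap F ∧
    (∀ b : B, (F ⁻¹' {b}).Finite ∧ (F ⁻¹' {b}).Nonempty) ∧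
    (∀ b₁ b₂ : B, (F ⁻¹' {b₁}).ncard = (F ⁻¹' {b₂}).ncard) := by
  have hlh : IsLocalHomeomorph F := by
    refine isLocalHomeomorph_iff_isOpenEmbedding_restrict.mpr fun a ↦ ?_
    obtain ⟨V, hV, haV, hFV, e, he⟩ := hloc a
    refine ⟨V, hV.mem_nhds haV, ?_⟩
    have hres : V.domRestrict F = Subtype.val ∘ e := funext fun v ↦ (he v).symm
    rw [hres]
    exact hFV.isOpenEmbedding_subtypeVal.comp e.isOpenEmbedding
  have hclosed : IsClosedMap F :=
    (isProperMap_iff_isCompact_preimage.mpr ⟨hc, fun K ↦ hproper K⟩).isClosedMap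
  have hpart : ∀ a, ∃ φ : OpenPartialHomeomorph A B, a ∈ φ.source ∧ φ = F := fun a ↦ by
    obtain ⟨φ, ha, h⟩ := hlh a
    exact ⟨φ, ha, h.symm⟩
  have hfin : ∀ b, (F ⁻¹' {b}).Finite := fun b ↦
    (hproper _ isCompact_singleton).finite
      (.of_openPartialHomeomorph F subset_rfl fun a _ ↦ hpart a)
  have hcov : IsCoveringMap F := fun b ↦
    hclosed.isEvenlyCovered_of_openPartialHomeomorph (hfin b) fun a _ ↦ hpart a
  exact ⟨hcov, fun b ↦ ⟨hfin b, hsurj b⟩,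
    hcov.isLocallyConstant_ncard_fiber.apply_eq_of_preconnectedSpace⟩
end

section
/- Assume the restriction F : D → Y is proper. Let y be a standard boundary value and let T₁ and T₂ be two distinct image tiles whose closures both contain y. Then for every p₁ ∈ T₁ and p₂ ∈ T₂ the fibers D ∩ F⁻¹({p₁}) and D ∩ F⁻¹({p₂}) are finite and their cardinalities differ by exactly 1. -/
open Set Topology

/-- `x` is a regular point of `F : U → Y`: `F` maps some open neighborhood of `x`
(contained in `U`) homeomorphically onto an open subset of `Y`. -/
def IsRegularAt {X Y : Type*} [TopologicalSpace X] [TopologicalSpace Y]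
    (F : X → Y) (U : Set X) (x : X) : Prop :=
  ∃ V : Set X, IsOpen V ∧ x ∈ V ∧ V ⊆ U ∧ IsOpen (F '' V) ∧
    ∃ e : ↥V ≃ₜ ↥(F '' V), ∀ v : ↥V, (e v : Y) = F v

/-- The critical set of the restriction `F : D → Y`: critical points of `F : U → Y`
lying in `D`. -/
def criticalSet {X Y : Type*} [TopologicalSpace X] [TopologicalSpace Y]
    (F : X → Y) (U D : Set X) : Set X :=
  {x ∈ D | ¬ IsRegularAt F U x}

/-- The flower `𝓕 = D ∩ F⁻¹(F(C ∪ ∂D))`. -/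
def flower {X Y : Type*} [TopologicalSpace X] [TopologicalSpace Y]
    (F : X → Y) (U D : Set X) : Set X :=
  D ∩ F ⁻¹' (F '' (criticalSet F U D ∪ frontier D))

/-- A domain tile: a connected component of `D \ 𝓕`. -/
def IsDomainTile {X Y : Type*} [TopologicalSpace X] [TopologicalSpace Y]
    (F : X → Y) (U D : Set X) (T : Set X) : Prop :=
  ∃ x ∈ D \ flower F U D, T = connectedComponentIn (D \ flower F U D) x

/-- An image tile: a connected component of `Y \ F(C ∪ ∂D)`. -/
def IsImageTile {X Y : Type*} [TopologicalSpace X] [TopologicalSpace Y]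
    (F : X → Y) (U D : Set X) (T : Set Y) : Prop :=
  ∃ y ∈ (F '' (criticalSet F U D ∪ frontier D))ᶜ,
    T = connectedComponentIn (F '' (criticalSet F U D ∪ frontier D))ᶜ y

/-- The data exhibiting `x ∈ ∂D` as a standard boundary point: there is an open
neighborhood `V ⊆ U` of `x` on which `F` restricts to a homeomorphism onto an open
subset of `Y`, and homeomorphisms identifying `V` with `R₀ × Z₀` (sending `x` to
`(0,0)`) and `F(V)` with an open subset of `ℝ × Z`, under which `F` becomes the
identity `(t,z) ↦ (t,z)`, `∂D ∩ V` corresponds to `{0} × Z₀` and `D ∩ V` to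
`{(t,z) : t ≥ 0}`. -/
structure StdBoundaryData {X Y : Type*} [TopologicalSpace X] [TopologicalSpace Y]
    (F : X → Y) (U D : Set X) (x : X) where
  Z : Type
  [instZ : NormedAddCommGroup Z]
  [instZ' : NormedSpace ℝ Z]
  [instZ'' : CompleteSpace Z]
  R₀ : Set ℝ
  Z₀ : Set Z
  openR₀ : IsOpen R₀
  memR₀ : (0 : ℝ) ∈ R₀
  openZ₀ : IsOpen Z₀
  memZ₀ : (0 : Z) ∈ Z₀
  V : Set X
  openV : IsOpen V
  memV : x ∈ V
  subV : V ⊆ U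
  openFV : IsOpen (F '' V)
  homeoFV : ∃ e : ↥V ≃ₜ ↥(F '' V), ∀ v : ↥V, (e v : Y) = F v
  W' : Set (ℝ × Z)
  openW' : IsOpen W'
  Φ : ↥(R₀ ×ˢ Z₀) ≃ₜ ↥V
  Ψ : ↥(F '' V) ≃ₜ ↥W'
  hΦx : (Φ ⟨(0, 0), Set.mk_mem_prod memR₀ memZ₀⟩ : X) = x
  hconj : ∀ p : ↥(R₀ ×ˢ Z₀),
    (Ψ ⟨F (Φ p), ⟨(Φ p : X), (Φ p).2, rfl⟩⟩ : ℝ × Z) = (p : ℝ × Z)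
  hfrontier : ∀ p : ↥(R₀ ×ˢ Z₀), ((Φ p : X) ∈ frontier D ↔ (p : ℝ × Z).1 = 0)
  hmemD : ∀ p : ↥(R₀ ×ˢ Z₀), ((Φ p : X) ∈ D ↔ 0 ≤ (p : ℝ × Z).1)

/-- `x` is a standard boundary point of `F : D → Y`. -/
def IsStdBoundaryPoint {X Y : Type*} [TopologicalSpace X] [TopologicalSpace Y]
    (F : X → Y) (U D : Set X) (x : X) : Prop :=
  x ∈ frontier D ∧ Nonempty (StdBoundaryData F U D x)

/-- `y ∈ F(∂D)` is a standard boundary value: its preimages in `D` consist of regular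
points lying in the interior of `D` together with exactly one point of `∂D`, which is
a standard boundary point. -/
def IsStdBoundaryValue {X Y : Type*} [TopologicalSpace X] [TopologicalSpace Y]
    (F : X → Y) (U D : Set X) (y : Y) : Prop :=
  y ∈ F '' frontier D ∧
  ∃ x₀ ∈ D ∩ F ⁻¹' {y}, IsStdBoundaryPoint F U D x₀ ∧
    (∀ x ∈ D ∩ F ⁻¹' {y}, x ≠ x₀ → x ∈ interior D ∧ IsRegularAt F U x)

section Regular

variable {X Y : Type*} [TopologicalSpace X] [TopologicalSpace Y] {F : X → Y} {U D : Set X}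

/-- A set of points around a regular point witnesses regularity of all its points. -/
lemma IsRegularAt.exists_isOpen {x : X} (h : IsRegularAt F U x) :
    ∃ V : Set X, IsOpen V ∧ x ∈ V ∧ InjOn F V ∧ (∀ v ∈ V, IsRegularAt F U v) ∧
      ∀ O ⊆ V, IsOpen O → IsOpen (F '' O) := by
  obtain ⟨V, hV, hxV, hVU, hFV, e, he⟩ := h
  refine ⟨V, hV, hxV, ?_, fun v hv => ⟨V, hV, hv, hVU, hFV, e, he⟩, ?_⟩
  · intro a ha b hb hab
    have : e ⟨a, ha⟩ = e ⟨b, hb⟩ := Subtype.ext (by rw [he, he]; exact hab)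
    simpa using e.injective this
  · intro O hOV hO
    have h1 : IsOpen ((↑) '' (e '' ((↑) ⁻¹' O : Set V)) : Set Y) :=
      hFV.isOpenMap_subtype_val _ (e.isOpenMap _ (hO.preimage continuous_subtype_val))
    convert h1 using 1
    ext q
    constructor
    · rintro ⟨x, hx, rfl⟩
      exact ⟨_, ⟨⟨x, hOV hx⟩, hx, rfl⟩, he _⟩
    · rintro ⟨_, ⟨v, hv, rfl⟩, rfl⟩
      exact ⟨v, hv, (he v).symm⟩

lemma isOpen_setOf_isRegularAt : IsOpen {x | IsRegularAt F U x} := by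
  rw [isOpen_iff_mem_nhds]
  intro x hx
  obtain ⟨V, hV, hxV, -, hreg, -⟩ := IsRegularAt.exists_isOpen hx
  exact Filter.mem_of_superset (hV.mem_nhds hxV) hreg

/-- A compact set of regular points on which `F` is constant is finite. -/
lemma IsCompact.finite_of_isRegularAt {S : Set X} {y : Y} (hS : IsCompact S)
    (hy : ∀ x ∈ S, F x = y) (hreg : ∀ x ∈ S, IsRegularAt F U x) : S.Finite := by
  have key : ∀ x ∈ S, ∃ V ∈ 𝓝 x, S ∩ V ⊆ {x} := by
    intro x hx
    obtain ⟨V, hV, hxV, hinj, -, -⟩ := (hreg x hx).exists_isOpen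
    exact ⟨V, hV.mem_nhds hxV, fun z hz => hinj hz.2 hxV ((hy z hz.1).trans (hy x hx).symm)⟩
  choose! V hV hSV using key
  obtain ⟨t, ht, hcover⟩ := hS.elim_nhds_subcover V hV
  refine t.finite_toSet.subset fun x hx => ?_
  obtain ⟨z, hz, hxz⟩ := mem_iUnion₂.1 (hcover hx)
  rw [show x = z from hSV z (ht z hz) ⟨hx, hxz⟩]
  exact hz

/-- Near the common value of `F` on a finite set `A` of regular points, each value has exactly
`A.ncard` preimages in a suitable neighborhood of `A`. -/
lemma Set.Finite.exists_isOpen_eventually_ncard_fiber [T2Space X] {A : Set X} (hA : A.Finite)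
    {y : Y} : ∀ O : Set X, IsOpen O → A ⊆ O → (∀ x ∈ A, F x = y) →
      (∀ x ∈ A, IsRegularAt F U x) →
      ∃ W, IsOpen W ∧ A ⊆ W ∧ W ⊆ O ∧
        ∀ᶠ q in 𝓝 y, (W ∩ F ⁻¹' {q}).Finite ∧ (W ∩ F ⁻¹' {q}).ncard = A.ncard := by
  induction A, hA using Set.Finite.induction_on with
  | empty =>
    intro O _ _ _ _
    exact ⟨∅, isOpen_empty, Subset.rfl, empty_subset _, by simp⟩
  | @insert a A haA hA ih =>
    intro O hO hAO hy hreg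
    obtain ⟨O₁, O₂, hO₁, hO₂, haO₁, hAO₂, hdisj⟩ :=
      SeparatedNhds.of_isCompact_isCompact (isCompact_singleton (x := a)) hA.isCompact
        (disjoint_singleton_left.2 haA)
    obtain ⟨W, hW, hAW, hWO, hcount⟩ := ih (O ∩ O₂) (hO.inter hO₂)
      (subset_inter ((subset_insert _ _).trans hAO) hAO₂)
      (fun x hx => hy x (mem_insert_of_mem _ hx)) (fun x hx => hreg x (mem_insert_of_mem _ hx))
    obtain ⟨V, hV, haV, hinj, -, hopen⟩ := (hreg a (mem_insert _ _)).exists_isOpen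
    have haO₁ : a ∈ O₁ := haO₁ rfl
    have hV' : IsOpen (V ∩ (O ∩ O₁)) := hV.inter (hO.inter hO₁)
    have haV' : a ∈ V ∩ (O ∩ O₁) := ⟨haV, hAO (mem_insert _ _), haO₁⟩
    refine ⟨V ∩ (O ∩ O₁) ∪ W, hV'.union hW, ?_, ?_, ?_⟩
    · exact insert_subset (Or.inl haV') (hAW.trans subset_union_right)
    · exact union_subset (fun x hx => hx.2.1) (fun x hx => (hWO hx).1)
    · have hnhds : F '' (V ∩ (O ∩ O₁)) ∈ 𝓝 y :=
        (hopen _ inter_subset_left hV').mem_nhds ⟨a, haV', hy a (mem_insert _ _)⟩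
      filter_upwards [hcount, hnhds] with q ⟨hfin, hcard⟩ hq
      obtain ⟨v, hv, rfl⟩ := hq
      have hvW : v ∉ W := fun h => disjoint_left.1 hdisj hv.2.2 (hWO h).2
      have heq : (V ∩ (O ∩ O₁) ∪ W) ∩ F ⁻¹' {F v} = insert v (W ∩ F ⁻¹' {F v}) := by
        ext x
        constructor
        · rintro ⟨hx | hx, hxv⟩
          · exact Or.inl (hinj hx.1 hv.1 hxv)
          · exact Or.inr ⟨hx, hxv⟩
        · rintro (rfl | hx)
          · exact ⟨Or.inl hv, rfl⟩
          · exact ⟨Or.inr hx.1, hx.2⟩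
      rw [heq]
      exact ⟨hfin.insert _, by
        rw [ncard_insert_of_notMem (fun h => hvW h.1) hfin, hcard, ncard_insert_of_notMem haA hA]⟩

lemma isRegularAt_of_notMem_image {p : Y} (hp : p ∉ F '' (criticalSet F U D ∪ frontier D))
    {x : X} (hx : x ∈ D ∩ F ⁻¹' {p}) : IsRegularAt F U x := by
  by_contra h
  exact hp ⟨x, Or.inl ⟨hx.1, h⟩, hx.2⟩

lemma mem_interior_of_notMem_image {p : Y} (hp : p ∉ F '' (criticalSet F U D ∪ frontier D))
    {x : X} (hx : x ∈ D ∩ F ⁻¹' {p}) : x ∈ interior D := by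
  by_contra h
  exact hp ⟨x, Or.inr ⟨subset_closure hx.1, h⟩, hx.2⟩

/-- The description of the half-neighborhoods of a standard boundary value cut out by a single
boundary sheet. -/
lemma StdBoundaryData.exists_sides {x₀ : X} (d : StdBoundaryData F U D x₀) {V₀ : Set X}
    (hV₀ : IsOpen V₀) (hx₀ : x₀ ∈ V₀) :
    ∃ V' : Set X, IsOpen V' ∧ x₀ ∈ V' ∧ V' ⊆ V₀ ∧ (∀ x ∈ V', IsRegularAt F U x) ∧
      ∀ N₀ ∈ 𝓝 (F x₀), ∃ N ∈ 𝓝 (F x₀), N ⊆ N₀ ∧ ∃ P M : Set Y, P ⊆ N ∧ M ⊆ N ∧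
        N ⊆ P ∪ M ∪ F '' frontier D ∧ IsPreconnected P ∧ IsPreconnected M ∧
        (∀ q ∈ P, ∃ x ∈ interior D, D ∩ V' ∩ F ⁻¹' {q} = {x}) ∧
        (∀ q ∈ M, D ∩ V' ∩ F ⁻¹' {q} = ∅) := by
  obtain ⟨Z, R₀, Z₀, hR₀, h0R, hZ₀, h0Z, V, hV, hxV, hVU, hFV, ⟨e, he⟩, -, -, Φ, -, hΦ, -,
    hfr, hmem⟩ := d
  have hBo : IsOpen (R₀ ×ˢ Z₀) := hR₀.prod hZ₀
  set o : ↥(R₀ ×ˢ Z₀) := ⟨(0, 0), mk_mem_prod h0R h0Z⟩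
  have hinj : ∀ p : ↥(R₀ ×ˢ Z₀), ∀ x ∈ V, F x = F (Φ p) → x = Φ p := by
    intro p x hx h
    have : e ⟨x, hx⟩ = e (Φ p) := Subtype.ext (by rw [he, he]; exact h)
    simpa using congrArg Subtype.val (e.injective this)
  set g : ↥(R₀ ×ˢ Z₀) → Y := fun p => F (Φ p)
  have hgcomp : g = (↑) ∘ e ∘ Φ := funext fun p => (he _).symm
  have hgc : Continuous g := by rw [hgcomp]; fun_prop
  have hgo : IsOpenMap g := by
    rw [hgcomp]
    exact hFV.isOpenMap_subtype_val.comp (e.isOpenMap.comp Φ.isOpenMap)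
  have hgO : g o = F x₀ := congrArg F hΦ
  refine ⟨V ∩ V₀, hV.inter hV₀, ⟨hxV, hx₀⟩, inter_subset_right,
    fun x hx => ⟨V, hV, hx.1, hVU, hFV, e, he⟩, fun N₀ hN₀ => ?_⟩
  have hQ : {p : ↥(R₀ ×ˢ Z₀) | (Φ p : X) ∈ V₀ ∧ g p ∈ N₀} ∈ 𝓝 o := by
    refine Filter.inter_mem ?_ (hgc.continuousAt.preimage_mem_nhds (hgO ▸ hN₀))
    exact (continuous_subtype_val.comp Φ.continuous).continuousAt.preimage_mem_nhds
      (hV₀.mem_nhds (show (Φ o : X) ∈ V₀ from hΦ ▸ hx₀))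
  have hQ' := hBo.isOpenMap_subtype_val.image_mem_nhds hQ
  obtain ⟨ε, hε, hball⟩ := Metric.mem_nhds_iff.1 hQ'
  have hballB : ∀ p ∈ Metric.ball (o : ℝ × Z) ε, ∃ h : p ∈ R₀ ×ˢ Z₀,
      (Φ ⟨p, h⟩ : X) ∈ V₀ ∧ g ⟨p, h⟩ ∈ N₀ := by
    intro p hp
    obtain ⟨p', hp', rfl⟩ := hball hp
    exact ⟨p'.2, hp'⟩
  have hconn : ∀ C : Set (ℝ × Z), Convex ℝ C →
      IsPreconnected (g '' {p : ↥(R₀ ×ˢ Z₀) | (p : ℝ × Z) ∈ Metric.ball (o : ℝ × Z) ε ∩ C}) := by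
    intro C hC
    refine IsPreconnected.image ?_ _ hgc.continuousOn
    rw [← IsInducing.subtypeVal.isPreconnected_image]
    have : ((↑) '' {p : ↥(R₀ ×ˢ Z₀) | (p : ℝ × Z) ∈ Metric.ball (o : ℝ × Z) ε ∩ C} : Set (ℝ × Z))
        = Metric.ball (o : ℝ × Z) ε ∩ C := by
      ext p
      constructor
      · rintro ⟨p', hp', rfl⟩
        exact hp'
      · intro hp
        exact ⟨⟨p, (hballB p hp.1).1⟩, hp, rfl⟩
    rw [this]
    exact ((convex_ball _ _).inter hC).isPreconnected
  refine ⟨g '' {p : ↥(R₀ ×ˢ Z₀) | (p : ℝ × Z) ∈ Metric.ball (o : ℝ × Z) ε}, ?_, ?_,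
    g '' {p : ↥(R₀ ×ˢ Z₀) | (p : ℝ × Z) ∈ Metric.ball (o : ℝ × Z) ε ∩ {p | 0 < p.1}},
    g '' {p : ↥(R₀ ×ˢ Z₀) | (p : ℝ × Z) ∈ Metric.ball (o : ℝ × Z) ε ∩ {p | p.1 < 0}},
    image_mono fun p hp => hp.1, image_mono fun p hp => hp.1, ?_,
    hconn _ (convex_halfSpace_gt (LinearMap.fst ℝ ℝ Z).isLinear 0),
    hconn _ (convex_halfSpace_lt (LinearMap.fst ℝ ℝ Z).isLinear 0), ?_, ?_⟩
  · rw [← hgO]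
    exact hgo.image_mem_nhds
      (continuous_subtype_val.continuousAt.preimage_mem_nhds (Metric.ball_mem_nhds _ hε))
  · rintro _ ⟨p, hp, rfl⟩
    exact (hballB p hp).2.2
  · rintro _ ⟨p, hp, rfl⟩
    rcases lt_trichotomy (p : ℝ × Z).1 0 with h | h | h
    · exact Or.inl (Or.inr ⟨p, ⟨hp, h⟩, rfl⟩)
    · exact Or.inr ⟨Φ p, (hfr p).2 h, rfl⟩
    · exact Or.inl (Or.inl ⟨p, ⟨hp, h⟩, rfl⟩)
  · rintro _ ⟨p, ⟨hp, hpos⟩, rfl⟩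
    have hpos : 0 < (p : ℝ × Z).1 := hpos
    have hD : (Φ p : X) ∈ D := (hmem p).2 hpos.le
    refine ⟨Φ p, ?_, ?_⟩
    · by_contra h
      exact hpos.ne' ((hfr p).1 ⟨subset_closure hD, h⟩)
    · ext x
      constructor
      · rintro ⟨⟨-, hx⟩, hxq⟩
        exact hinj p x hx.1 hxq
      · rintro rfl
        exact ⟨⟨hD, (Φ p).2, (hballB p hp).2.1⟩, rfl⟩
  · rintro _ ⟨p, ⟨hp, hneg⟩, rfl⟩
    have hneg : (p : ℝ × Z).1 < 0 := hneg
    refine eq_empty_of_forall_notMem ?_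
    rintro x ⟨⟨hxD, hx⟩, hxq⟩
    rw [hinj p x hx.1 hxq] at hxD
    exact hneg.not_ge ((hmem p).1 hxD)

end Regular

section Proper

variable {X Y : Type*} [TopologicalSpace X] [TopologicalSpace Y]
  {F : X → Y} {U D : Set X}

/-- Fibers of a proper restriction vary upper semicontinuously. -/
lemma eventually_fiber_subset [T2Space Y] [CompactlyCoherentSpace Y] (hF : ContinuousOn F D)
    (hproper : ∀ K : Set Y, IsCompact K → IsCompact (D ∩ F ⁻¹' K)) {y : Y} {W : Set X}
    (hW : IsOpen W) (hy : D ∩ F ⁻¹' {y} ⊆ W) : ∀ᶠ q in 𝓝 y, D ∩ F ⁻¹' {q} ⊆ W := by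
  have hp : IsProperMap (D.domRestrict F) := by
    rw [isProperMap_iff_isCompact_preimage]
    refine ⟨hF.domRestrict, fun K hK => ?_⟩
    rw [Subtype.isCompact_iff]
    convert hproper K hK using 1
    ext x
    simp [Set.domRestrict, and_comm]
  have hcl : IsClosed (D.domRestrict F '' ((↑) ⁻¹' Wᶜ)) :=
    hp.isClosedMap _ (hW.isClosed_compl.preimage continuous_subtype_val)
  have hmem : (D.domRestrict F '' ((↑) ⁻¹' Wᶜ))ᶜ ∈ 𝓝 y := by
    refine hcl.isOpen_compl.mem_nhds ?_
    rintro ⟨x, hx, hxy⟩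
    exact hx (hy ⟨x.2, hxy⟩)
  filter_upwards [hmem] with q hq x hx
  by_contra h
  exact hq ⟨⟨x, hx.1⟩, h, hx.2⟩

lemma finite_fiber (hproper : ∀ K : Set Y, IsCompact K → IsCompact (D ∩ F ⁻¹' K)) {p : Y}
    (hp : p ∉ F '' (criticalSet F U D ∪ frontier D)) : (D ∩ F ⁻¹' {p}).Finite :=
  (hproper _ isCompact_singleton).finite_of_isRegularAt (fun _ hx => hx.2)
    fun _ hx => isRegularAt_of_notMem_image hp hx

/-- The number of preimages is constant on connected sets avoiding `F(C ∪ ∂D)`. -/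
lemma IsPreconnected.ncard_fiber_eq [T2Space X] [T2Space Y] [CompactlyCoherentSpace Y]
    (hF : ContinuousOn F D)
    (hproper : ∀ K : Set Y, IsCompact K → IsCompact (D ∩ F ⁻¹' K)) {T : Set Y}
    (hT : IsPreconnected T) (hTc : T ⊆ (F '' (criticalSet F U D ∪ frontier D))ᶜ)
    {p q : Y} (hp : p ∈ T) (hq : q ∈ T) :
    (D ∩ F ⁻¹' {p}).ncard = (D ∩ F ⁻¹' {q}).ncard := by
  refine hT.constant (f := fun p => (D ∩ F ⁻¹' {p}).ncard) (fun r hr => ?_) hp hq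
  have hr := hTc hr
  obtain ⟨W, hW, hAW, hWD, hcount⟩ :=
    (finite_fiber hproper hr).exists_isOpen_eventually_ncard_fiber (F := F) (U := U) (y := r)
      (interior D) isOpen_interior (fun x hx => mem_interior_of_notMem_image hr hx)
      (fun x hx => hx.2) (fun x hx => isRegularAt_of_notMem_image hr hx)
  refine ContinuousAt.continuousWithinAt (tendsto_nhds_of_eventually_eq ?_)
  filter_upwards [hcount, eventually_fiber_subset hF hproper hW hAW] with s hs hsW
  rw [← hs.2]
  congr 1
  exact Subset.antisymm (fun x hx => ⟨hsW hx, hx.2⟩)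
    fun x hx => ⟨interior_subset (hWD hx.1), hx.2⟩

/-- A standard boundary value has a neighborhood covered by `F(∂D)` and two connected sets
avoiding `F(C ∪ ∂D)` on which the numbers of preimages are `n + 1` and `n` respectively. -/
lemma IsStdBoundaryValue.exists_sides [T2Space X] [T2Space Y] [CompactlyCoherentSpace Y]
    (hD : IsClosed D) (hF : ContinuousOn F D)
    (hproper : ∀ K : Set Y, IsCompact K → IsCompact (D ∩ F ⁻¹' K)) {y : Y}
    (hy : IsStdBoundaryValue F U D y) :
    ∃ N ∈ 𝓝 y, ∃ (P M : Set Y) (n : ℕ), N ⊆ P ∪ M ∪ F '' frontier D ∧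
      IsPreconnected P ∧ IsPreconnected M ∧
      P ⊆ (F '' (criticalSet F U D ∪ frontier D))ᶜ ∧
      M ⊆ (F '' (criticalSet F U D ∪ frontier D))ᶜ ∧
      (∀ q ∈ P, (D ∩ F ⁻¹' {q}).ncard = n + 1) ∧ (∀ q ∈ M, (D ∩ F ⁻¹' {q}).ncard = n) := by
  obtain ⟨-, x₀, ⟨-, rfl⟩, ⟨-, ⟨d⟩⟩, hother⟩ := hy
  have hreg₀ : IsRegularAt F U x₀ := ⟨d.V, d.openV, d.memV, d.subV, d.openFV, d.homeoFV⟩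
  have hfin : (D ∩ F ⁻¹' {F x₀}).Finite := by
    refine (hproper _ isCompact_singleton).finite_of_isRegularAt (F := F) (U := U)
      (fun _ hx => hx.2) fun x hx => ?_
    by_cases h : x = x₀
    · exact h ▸ hreg₀
    · exact (hother x hx h).2
  set A := (D ∩ F ⁻¹' {F x₀}) \ {x₀}
  have hA : A.Finite := hfin.subset sdiff_subset
  obtain ⟨V₀, O, hV₀, hO, hxV₀, hAO, hdisj⟩ :=
    SeparatedNhds.of_isCompact_isCompact (isCompact_singleton (x := x₀)) hA.isCompact
      (disjoint_singleton_left.2 fun h => h.2 rfl)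
  obtain ⟨W, hW, hAW, hWO, hcount⟩ := hA.exists_isOpen_eventually_ncard_fiber (F := F) (U := U)
    (y := F x₀) (O ∩ (interior D ∩ {x | IsRegularAt F U x}))
    (hO.inter (isOpen_interior.inter isOpen_setOf_isRegularAt))
    (fun x hx => ⟨hAO hx, hother x hx.1 hx.2⟩) (fun x hx => hx.1.2)
    (fun x hx => (hother x hx.1 hx.2).2)
  obtain ⟨V', hV', hxV', hV'V₀, hV'reg, hsides⟩ := d.exists_sides hV₀ (hxV₀ rfl)
  have hsub := eventually_fiber_subset hF hproper (hW.union hV') (y := F x₀) (fun x hx => by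
    by_cases h : x = x₀
    · exact Or.inr (h ▸ hxV')
    · exact Or.inl (hAW ⟨hx, h⟩))
  obtain ⟨N, hN, hNN₀, P, M, hPN, hMN, hcover, hP, hM, hPc, hMc⟩ := hsides _ (hcount.and hsub)
  have hsplit : ∀ q ∈ N, D ∩ F ⁻¹' {q} = (W ∩ F ⁻¹' {q}) ∪ (D ∩ V' ∩ F ⁻¹' {q}) := by
    intro q hq
    ext x
    constructor
    · intro hx
      exact ((hNN₀ hq).2 hx).imp (fun h => ⟨h, hx.2⟩) (fun h => ⟨⟨hx.1, h⟩, hx.2⟩)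
    · rintro (hx | hx)
      · exact ⟨interior_subset (hWO hx.1).2.1, hx.2⟩
      · exact ⟨hx.1.1, hx.2⟩
  have havoid : ∀ q ∈ N, D ∩ V' ∩ F ⁻¹' {q} ⊆ interior D →
      q ∈ (F '' (criticalSet F U D ∪ frontier D))ᶜ := by
    rintro q hq hint ⟨x, hx, rfl⟩
    have hxD : x ∈ D := by
      rcases hx with hx | hx
      · exact hx.1
      · exact hD.frontier_subset hx
    have hmem : x ∈ D ∩ F ⁻¹' {F x} := ⟨hxD, rfl⟩
    have hgood : x ∈ interior D ∧ IsRegularAt F U x := by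
      rw [hsplit _ hq] at hmem
      rcases hmem with h | h
      · exact (hWO h.1).2
      · exact ⟨hint h, hV'reg x h.1.2⟩
    rcases hx with hx | hx
    · exact hx.2 hgood.2
    · exact hx.2 hgood.1
  refine ⟨N, hN, P, M, A.ncard, hcover, hP, hM, fun q hq => ?_, fun q hq => ?_, fun q hq => ?_,
    fun q hq => ?_⟩
  · obtain ⟨x, hx, heq⟩ := hPc q hq
    exact havoid q (hPN hq) (by rw [heq]; exact singleton_subset_iff.2 hx)
  · exact havoid q (hMN hq) (by rw [hMc q hq]; exact empty_subset _)
  · obtain ⟨x, -, heq⟩ := hPc q hq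
    have hxV : x ∈ D ∩ V' ∩ F ⁻¹' {q} := heq ▸ rfl
    have hcq := (hNN₀ (hPN hq)).1
    rw [hsplit q (hPN hq), heq, union_singleton, ncard_insert_of_notMem _ hcq.1, hcq.2]
    exact fun h => disjoint_left.1 hdisj (hV'V₀ hxV.1.2) (hWO h.1).1
  · rw [hsplit q (hMN hq), hMc q hq, union_empty, (hNN₀ (hMN hq)).1.2]

lemma IsImageTile.eq_connectedComponentIn {T : Set Y} (hT : IsImageTile F U D T) {p : Y}
    (hp : p ∈ T) : T = connectedComponentIn (F '' (criticalSet F U D ∪ frontier D))ᶜ p := by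
  obtain ⟨r, -, rfl⟩ := hT
  exact connectedComponentIn_eq hp

lemma IsImageTile.subset {T : Set Y} (hT : IsImageTile F U D T) :
    T ⊆ (F '' (criticalSet F U D ∪ frontier D))ᶜ := by
  obtain ⟨r, -, rfl⟩ := hT
  exact connectedComponentIn_subset _ _

lemma IsImageTile.isPreconnected {T : Set Y} (hT : IsImageTile F U D T) :
    IsPreconnected T := by
  obtain ⟨r, -, rfl⟩ := hT
  exact isPreconnected_connectedComponentIn

/-- Two image tiles meeting the same connected set that avoids `F(C ∪ ∂D)` coincide. -/
lemma IsImageTile.eq_of_isPreconnected {T₁ T₂ P : Set Y} (h₁ : IsImageTile F U D T₁)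
    (h₂ : IsImageTile F U D T₂) (hP : IsPreconnected P)
    (hPc : P ⊆ (F '' (criticalSet F U D ∪ frontier D))ᶜ) {q₁ q₂ : Y} (hq₁ : q₁ ∈ T₁)
    (hq₂ : q₂ ∈ T₂) (hp₁ : q₁ ∈ P) (hp₂ : q₂ ∈ P) : T₁ = T₂ := by
  rw [h₁.eq_connectedComponentIn hq₁, h₂.eq_connectedComponentIn hq₂]
  exact connectedComponentIn_eq (hP.subset_connectedComponentIn hp₁ hPc hp₂)

end Proper

theorem statement5
    {X Y : Type*}
    [NormedAddCommGroup X] [NormedSpace ℝ X] [CompleteSpace X]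
    [NormedAddCommGroup Y] [NormedSpace ℝ Y] [CompleteSpace Y]
    (F : X → Y) (U : Set X) (hU : IsOpen U) (hF : ContinuousOn F U)
    (D : Set X) (hD : IsClosed D) (hDU : D ⊆ U)
    (hproper : ∀ K : Set Y, IsCompact K → IsCompact (D ∩ F ⁻¹' K))
    (y : Y) (hy : IsStdBoundaryValue F U D y)
    (T₁ T₂ : Set Y) (hT₁ : IsImageTile F U D T₁) (hT₂ : IsImageTile F U D T₂)
    (hne : T₁ ≠ T₂) (hy₁ : y ∈ closure T₁) (hy₂ : y ∈ closure T₂) :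
    ∀ p₁ ∈ T₁, ∀ p₂ ∈ T₂,
      (D ∩ F ⁻¹' {p₁}).Finite ∧ (D ∩ F ⁻¹' {p₂}).Finite ∧
      ((D ∩ F ⁻¹' {p₁}).ncard = (D ∩ F ⁻¹' {p₂}).ncard + 1 ∨
       (D ∩ F ⁻¹' {p₂}).ncard = (D ∩ F ⁻¹' {p₁}).ncard + 1) := by
  have hFD : ContinuousOn F D := hF.mono hDU
  obtain ⟨N, hN, P, M, n, hcover, hP, hM, hPc, hMc, hPn, hMn⟩ := hy.exists_sides hD hFD hproper
  have hside : ∀ T, IsImageTile F U D T → y ∈ closure T → ∃ q ∈ T, q ∈ P ∨ q ∈ M := by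
    intro T hT hyT
    obtain ⟨q, hqN, hqT⟩ := mem_closure_iff_nhds.1 hyT N hN
    rcases hcover hqN with h | ⟨x, hx, rfl⟩
    · exact ⟨q, hqT, h⟩
    · exact absurd ⟨x, Or.inr hx, rfl⟩ (hT.subset hqT)
  intro p₁ hp₁ p₂ hp₂
  refine ⟨finite_fiber hproper (hT₁.subset hp₁), finite_fiber hproper (hT₂.subset hp₂), ?_⟩
  obtain ⟨q₁, hq₁, h₁⟩ := hside T₁ hT₁ hy₁
  obtain ⟨q₂, hq₂, h₂⟩ := hside T₂ hT₂ hy₂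
  rw [hT₁.isPreconnected.ncard_fiber_eq hFD hproper hT₁.subset hp₁ hq₁,
    hT₂.isPreconnected.ncard_fiber_eq hFD hproper hT₂.subset hp₂ hq₂]
  rcases h₁ with h₁ | h₁ <;> rcases h₂ with h₂ | h₂
  · exact absurd (hT₁.eq_of_isPreconnected hT₂ hP hPc hq₁ hq₂ h₁ h₂) hne
  · exact Or.inl (by rw [hPn _ h₁, hMn _ h₂])
  · exact Or.inr (by rw [hMn _ h₁, hPn _ h₂])
  · exact absurd (hT₁.eq_of_isPreconnected hT₂ hM hMc hq₁ hq₂ h₁ h₂) hne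
end
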